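/- arXiv:1607.04819 — 3 statements merged into one kernel-verified Lean document; each statement's English description precedes it below -/
import Mathlib

section
/- Let V be a finite set with |V| ≥ 2, H a polymatroid rank function on V, and set α = R_ACO(V) = max over partitions P of V with |P| ≥ 2 of Σ_{X∈P} (H(V) − H(X)) / (|P| − 1). Then a partition P of V minimizes P ↦ Σ_{X∈P} f^#_α(X) (with minimum value α) if and only if either P = {V} or P attains the maximum defining R_ACO(V), i.e., Σ_{X∈P} (H(V) − H(X)) / (|P| − 1) = R_ACO(V). In particular, the fundamental partition (any maximizer of the R_ACO formula) is a minimizer of the Dilworth truncation problem at α = R_ACO(V). -/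
open Finset

/-- `H` is a polymatroid rank function on the ground set `V`: normalized, monotone
and submodular. -/
def IsPolymatroid {V : Type*} [Fintype V] [DecidableEq V] (H : Finset V → ℝ) : Prop :=
  H ∅ = 0 ∧ (∀ ⦃X Y : Finset V⦄, Y ⊆ X → H Y ≤ H X) ∧
    ∀ X Y : Finset V, H (X ∩ Y) + H (X ∪ Y) ≤ H X + H Y

/-- `P` is a partition of `W`: nonempty pairwise disjoint blocks whose union is `W`. -/
def IsPartitionOf {V : Type*} [DecidableEq V] (W : Finset V) (P : Finset (Finset V)) : Prop :=
  (∀ X ∈ P, X.Nonempty) ∧ (∀ X ∈ P, ∀ Y ∈ P, X ≠ Y → Disjoint X Y) ∧ P.biUnion id = W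

/-- The quantity `Σ_{X ∈ P} (H(V) - H(X)) / (|P| - 1)` associated with a partition `P`. -/
noncomputable def partitionRate {V : Type*} [Fintype V] (H : Finset V → ℝ)
    (P : Finset (Finset V)) : ℝ :=
  ∑ X ∈ P, (H Finset.univ - H X) / ((P.card : ℝ) - 1)

/-- The set of values `Σ_{X ∈ P} (H(V) - H(X)) / (|P| - 1)` over partitions `P` of `V`
with at least two blocks; its maximum is `R_ACO(V)`. -/
def RACOSet {V : Type*} [Fintype V] [DecidableEq V] (H : Finset V → ℝ) : Set ℝ :=
  {t | ∃ P : Finset (Finset V),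
    IsPartitionOf Finset.univ P ∧ 2 ≤ P.card ∧ t = partitionRate H P}

/-- The dual set function `f^#_α`: `f^#_α(∅) = 0` and
`f^#_α(X) = α - H(V) + H(X)` for nonempty `X`. -/
noncomputable def fhash {V : Type*} [Fintype V] [DecidableEq V] (H : Finset V → ℝ) (α : ℝ)
    (X : Finset V) : ℝ :=
  if X = ∅ then 0 else α - H Finset.univ + H X

/-- `{W}` is the only partition of a nonempty set `W` with fewer than two blocks. -/
theorem IsPartitionOf.eq_singleton_or_two_le_card {V : Type*} [DecidableEq V] {W : Finset V}
    (hW : W.Nonempty) {P : Finset (Finset V)} (hP : IsPartitionOf W P) :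
    P = {W} ∨ 2 ≤ P.card := by
  obtain ⟨-, -, hU⟩ := hP
  rcases Nat.lt_or_ge P.card 2 with h | h
  · left
    rcases Nat.lt_or_ge P.card 1 with h0 | h1
    · obtain rfl : P = ∅ := Finset.card_eq_zero.mp (by omega)
      simp only [Finset.biUnion_empty] at hU
      exact absurd hU.symm hW.ne_empty
    · obtain ⟨X, rfl⟩ := Finset.card_eq_one.mp (by omega : P.card = 1)
      simpa using hU
  · exact Or.inr h

theorem isPartitionOf_singleton {V : Type*} [DecidableEq V] {W : Finset V} (hW : W.Nonempty) :
    IsPartitionOf W {W} := by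
  refine ⟨by simpa using hW, ?_, by simp⟩
  intro X hX Y hY hne
  rw [Finset.mem_singleton] at hX hY
  exact absurd (hX.trans hY.symm) hne

theorem sum_fhash_singleton_univ {V : Type*} [Fintype V] [DecidableEq V] [Nonempty V]
    (H : Finset V → ℝ) (α : ℝ) :
    ∑ X ∈ ({Finset.univ} : Finset (Finset V)), fhash H α X = α := by
  rw [Finset.sum_singleton, fhash, if_neg Finset.univ_nonempty.ne_empty]
  ring

theorem sum_fhash_eq_add_mul_sub_partitionRate {V : Type*} [Fintype V] [DecidableEq V]
    (H : Finset V → ℝ) (α : ℝ) {P : Finset (Finset V)} (hne : ∀ X ∈ P, X.Nonempty)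
    (hcard : 2 ≤ P.card) :
    ∑ X ∈ P, fhash H α X = α + ((P.card : ℝ) - 1) * (α - partitionRate H P) := by
  have hcard' : (2 : ℝ) ≤ P.card := by exact_mod_cast hcard
  have hpos : (P.card : ℝ) - 1 ≠ 0 := by linarith
  have hrate : ((P.card : ℝ) - 1) * partitionRate H P = ∑ X ∈ P, (H Finset.univ - H X) := by
    rw [partitionRate, ← Finset.sum_div, mul_div_cancel₀ _ hpos]
  have hsum : ∑ X ∈ P, fhash H α X = ∑ X ∈ P, (α - (H Finset.univ - H X)) := by
    refine Finset.sum_congr rfl fun X hX => ?_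
    rw [fhash, if_neg (hne X hX).ne_empty]
    ring
  rw [hsum, Finset.sum_sub_distrib, Finset.sum_const, nsmul_eq_mul, mul_sub, hrate]
  ring

/-- at `α = R_ACO(V)`, a partition `P` of `V` minimizes
`P ↦ Σ_{X ∈ P} f^#_α(X)` iff `P = {V}` or `P` attains the maximum defining `R_ACO(V)`;
moreover the minimum value is `α`. -/
theorem minimizers_at_RACO {V : Type*} [Fintype V] [DecidableEq V]
    (H : Finset V → ℝ) (hV : 2 ≤ Fintype.card V) (hH : IsPolymatroid H)
    (γ : ℝ) (hγ : IsGreatest (RACOSet H) γ) :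
    (∀ P : Finset (Finset V), IsPartitionOf Finset.univ P →
      ((∀ Q : Finset (Finset V), IsPartitionOf Finset.univ Q →
          ∑ X ∈ P, fhash H γ X ≤ ∑ X ∈ Q, fhash H γ X)
        ↔ (P = {Finset.univ} ∨ (2 ≤ P.card ∧ partitionRate H P = γ)))) ∧
    (∀ P : Finset (Finset V), IsPartitionOf Finset.univ P →
      (∀ Q : Finset (Finset V), IsPartitionOf Finset.univ Q →
        ∑ X ∈ P, fhash H γ X ≤ ∑ X ∈ Q, fhash H γ X) →
      ∑ X ∈ P, fhash H γ X = γ) := by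
  have : Nonempty V := Fintype.card_pos_iff.mp (by omega)
  have hW : (Finset.univ : Finset V).Nonempty := Finset.univ_nonempty
  have hlower : ∀ Q : Finset (Finset V), IsPartitionOf Finset.univ Q →
      γ ≤ ∑ X ∈ Q, fhash H γ X := by
    intro Q hQ
    rcases hQ.eq_singleton_or_two_le_card hW with rfl | hcard
    · exact (sum_fhash_singleton_univ H γ).ge
    · have hle : partitionRate H Q ≤ γ := hγ.2 ⟨Q, hQ, hcard, rfl⟩
      have hcard' : (2 : ℝ) ≤ Q.card := by exact_mod_cast hcard
      rw [sum_fhash_eq_add_mul_sub_partitionRate H γ hQ.1 hcard]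
      exact le_add_of_nonneg_right (mul_nonneg (by linarith) (by linarith))
  have hvalue : ∀ P : Finset (Finset V), IsPartitionOf Finset.univ P →
      (∀ Q : Finset (Finset V), IsPartitionOf Finset.univ Q →
        ∑ X ∈ P, fhash H γ X ≤ ∑ X ∈ Q, fhash H γ X) →
      ∑ X ∈ P, fhash H γ X = γ := fun P hP hmin =>
    le_antisymm ((hmin _ (isPartitionOf_singleton hW)).trans_eq (sum_fhash_singleton_univ H γ))
      (hlower P hP)
  refine ⟨fun P hP => ⟨fun hmin => ?_, ?_⟩, hvalue⟩
  · refine (hP.eq_singleton_or_two_le_card hW).imp_right fun hcard => ⟨hcard, ?_⟩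
    have hsum := hvalue P hP hmin
    have hcard' : (2 : ℝ) ≤ P.card := by exact_mod_cast hcard
    rw [sum_fhash_eq_add_mul_sub_partitionRate H γ hP.1 hcard, add_eq_left, mul_eq_zero] at hsum
    rcases hsum with h | h <;> linarith
  · rintro (rfl | ⟨hcard, hrate⟩) Q hQ
    · exact (sum_fhash_singleton_univ H γ).trans_le (hlower Q hQ)
    · rw [sum_fhash_eq_add_mul_sub_partitionRate H γ hP.1 hcard, hrate, sub_self, mul_zero,
        add_zero]
      exact hlower Q hQ
end

section
/- Let V be a finite set with |V| ≥ 2, H a polymatroid rank function on V, and α ∈ ℝ with α ≥ R_ACO(V), where R_ACO(V) = max over partitions P of V with |P| ≥ 2 of Σ_{X∈P} (H(V) − H(X)) / (|P| − 1). Let f̂_α be the Dilworth truncation of f^#_α, i.e., f̂_α(X) = min over partitions P of X of Σ_{Y∈P} f^#_α(Y). Then f̂_α(V) = α and the base polyhedra coincide: { r ∈ ℝ^V : r(X) ≤ f̂_α(X) for all X ⊆ V, r(V) = f̂_α(V) } = { r ∈ ℝ^V : r(X) ≤ f^#_α(X) for all X ⊆ V, r(V) = α }. -/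
open Finset

/-- The Dilworth truncation `ĝ(X) = min_{P partition of X} Σ_{Y ∈ P} g(Y)`
(the empty set has the empty partition, so `ĝ(∅) = 0`). -/
noncomputable def dilworth {V : Type*} [DecidableEq V] (g : Finset V → ℝ) (X : Finset V) : ℝ :=
  sInf {s : ℝ | ∃ P : Finset (Finset V), IsPartitionOf X P ∧ s = ∑ Y ∈ P, g Y}

theorem isPartitionOf_singleton_s10 {V : Type*} [DecidableEq V] {X : Finset V} (hX : X.Nonempty) :
    IsPartitionOf X {X} := by
  refine ⟨by simpa using hX, ?_, by simp⟩
  intro A hA B hB hAB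
  rw [Finset.mem_singleton] at hA hB
  exact absurd (hA.trans hB.symm) hAB

theorem exists_isPartitionOf {V : Type*} [DecidableEq V] (X : Finset V) :
    ∃ P, IsPartitionOf X P := by
  rcases X.eq_empty_or_nonempty with rfl | hX
  · exact ⟨∅, by simp [IsPartitionOf]⟩
  · exact ⟨{X}, isPartitionOf_singleton_s10 hX⟩

theorem le_dilworth_iff {V : Type*} [Finite V] [DecidableEq V] {g : Finset V → ℝ}
    {X : Finset V} {c : ℝ} :
    c ≤ dilworth g X ↔ ∀ P, IsPartitionOf X P → c ≤ ∑ Y ∈ P, g Y := by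
  have hfin : {s : ℝ | ∃ P, IsPartitionOf X P ∧ s = ∑ Y ∈ P, g Y}.Finite := by
    refine (Set.finite_range fun P : Finset (Finset V) => ∑ Y ∈ P, g Y).subset ?_
    rintro s ⟨P, -, rfl⟩
    exact ⟨P, rfl⟩
  obtain ⟨Q, hQ⟩ := exists_isPartitionOf X
  rw [dilworth, le_csInf_iff hfin.bddBelow ⟨_, Q, hQ, rfl⟩]
  constructor
  · exact fun h P hP => h _ ⟨P, hP, rfl⟩
  · rintro h _ ⟨P, hP, rfl⟩
    exact h P hP

theorem IsPartitionOf.sum_sum {V : Type*} [DecidableEq V] {X : Finset V}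
    {P : Finset (Finset V)} (hP : IsPartitionOf X P) (r : V → ℝ) :
    ∑ Y ∈ P, ∑ i ∈ Y, r i = ∑ i ∈ X, r i := by
  rw [← hP.2.2]
  exact (Finset.sum_biUnion (t := id) fun A hA B hB hAB => hP.2.1 A hA B hB hAB).symm

/-- A modular function is dominated by `g` if and only if it is dominated by the Dilworth
truncation of `g`. -/
theorem forall_sum_le_dilworth_iff {V : Type*} [Finite V] [DecidableEq V] {g : Finset V → ℝ}
    (hg : 0 ≤ g ∅) (r : V → ℝ) :
    (∀ X : Finset V, ∑ i ∈ X, r i ≤ dilworth g X) ↔ ∀ X : Finset V, ∑ i ∈ X, r i ≤ g X := by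
  constructor
  · intro h X
    rcases X.eq_empty_or_nonempty with rfl | hX
    · simpa using hg
    · simpa using le_dilworth_iff.1 (h X) {X} (isPartitionOf_singleton_s10 hX)
  · intro h X
    refine le_dilworth_iff.2 fun P hP => ?_
    rw [← hP.sum_sum r]
    exact Finset.sum_le_sum fun Y _ => h Y

theorem IsPartitionOf.sum_fhash {V : Type*} [Fintype V] [DecidableEq V] {X : Finset V}
    {P : Finset (Finset V)} (hP : IsPartitionOf X P) (H : Finset V → ℝ) (α : ℝ) :
    ∑ Y ∈ P, fhash H α Y = P.card * α - ∑ Y ∈ P, (H Finset.univ - H Y) := by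
  rw [← nsmul_eq_mul, ← Finset.sum_const, ← Finset.sum_sub_distrib]
  refine Finset.sum_congr rfl fun Y hY => ?_
  rw [fhash, if_neg (hP.1 Y hY).ne_empty]
  ring

theorem dilworth_fhash_univ {V : Type*} [Fintype V] [DecidableEq V] [Nonempty V]
    {H : Finset V → ℝ} {α : ℝ} (hα : α ∈ upperBounds (RACOSet H)) :
    dilworth (fhash H α) Finset.univ = α := by
  apply le_antisymm
  · simpa [fhash, Finset.univ_nonempty.ne_empty] using
      le_dilworth_iff.1 (le_refl (dilworth (fhash H α) _)) {Finset.univ}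
        (isPartitionOf_singleton_s10 (Finset.univ_nonempty (α := V)))
  · refine le_dilworth_iff.2 fun P hP => ?_
    rw [hP.sum_fhash]
    obtain h0 | h1 | h2 : P.card = 0 ∨ P.card = 1 ∨ 2 ≤ P.card := by lia
    · rw [Finset.card_eq_zero] at h0
      have hu := hP.2.2
      rw [h0, Finset.biUnion_empty] at hu
      exact absurd hu.symm Finset.univ_nonempty.ne_empty
    · obtain ⟨X, rfl⟩ := Finset.card_eq_one.1 h1
      obtain rfl : X = Finset.univ := by simpa using hP.2.2
      simp
    · have hrate : partitionRate H P ≤ α := hα ⟨P, hP, h2, rfl⟩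
      have hcard : (2 : ℝ) ≤ P.card := by exact_mod_cast h2
      rw [partitionRate, ← Finset.sum_div, div_le_iff₀ (by linarith)] at hrate
      linarith

/-- for `α ≥ R_ACO(V)`, the Dilworth truncation satisfies `f̂_α(V) = α`
and its base polyhedron coincides with that of `f^#_α`. -/
theorem dilworth_base_polyhedron_eq {V : Type*} [Fintype V] [DecidableEq V]
    (H : Finset V → ℝ) (hV : 2 ≤ Fintype.card V) (hH : IsPolymatroid H)
    (γ : ℝ) (hγ : IsGreatest (RACOSet H) γ) (α : ℝ) (hα : γ ≤ α) :
    dilworth (fhash H α) Finset.univ = α ∧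
    {r : V → ℝ | (∀ X : Finset V, ∑ i ∈ X, r i ≤ dilworth (fhash H α) X) ∧
        ∑ i, r i = dilworth (fhash H α) Finset.univ}
      = {r : V → ℝ | (∀ X : Finset V, ∑ i ∈ X, r i ≤ fhash H α X) ∧ ∑ i, r i = α} := by
  have : Nonempty V := Fintype.card_pos_iff.1 (by lia)
  have huniv : dilworth (fhash H α) Finset.univ = α :=
    dilworth_fhash_univ fun _ ht => (hγ.2 ht).trans hα
  refine ⟨huniv, ?_⟩
  ext r
  rw [Set.mem_ofPred_eq, Set.mem_ofPred_eq, huniv,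
    forall_sum_le_dilworth_iff (by simp [fhash]) r]
end

section
/- Let V be a finite set with |V| ≥ 2, H a polymatroid rank function on V, and α ∈ ℝ. Let W ⊊ V, let P* be a partition of W, and let φ ∈ V ∖ W. Let r ∈ ℝ^V satisfy r(Z) ≤ f^#_α(Z) for all Z ⊆ V and r(Y) = f^#_α(Y) for every block Y ∈ P*. Then (fusion lemma) min{ f^#_α(X) − r(X) : φ ∈ X ⊆ W ∪ {φ} } = min{ f^#_α({φ} ∪ Ũ) − r({φ} ∪ Ũ) : U ⊆ P* }, where Ũ = ∪_{Y∈U} Y. -/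
open Finset

/-- The dual set function is submodular on intersecting pairs. -/
theorem fhash_inter_add_fhash_union_le {V : Type*} [Fintype V] [DecidableEq V]
    {H : Finset V → ℝ} (hH : IsPolymatroid H) (α : ℝ) {X Y : Finset V}
    (hXY : (X ∩ Y).Nonempty) :
    fhash H α (X ∩ Y) + fhash H α (X ∪ Y) ≤ fhash H α X + fhash H α Y := by
  have hX : X.Nonempty := hXY.mono inter_subset_left
  have hY : Y.Nonempty := hXY.mono inter_subset_right
  have hU : (X ∪ Y).Nonempty := hX.mono subset_union_left
  simp only [fhash, if_neg hXY.ne_empty, if_neg hX.ne_empty, if_neg hY.ne_empty,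
    if_neg hU.ne_empty]
  linarith [hH.2.2 X Y]

/-- Absorbing a tight set that meets `X` does not increase the slack of `X`. -/
theorem fhash_sub_sum_union_le {V : Type*} [Fintype V] [DecidableEq V]
    {H : Finset V → ℝ} (hH : IsPolymatroid H) {α : ℝ} {r : V → ℝ}
    (hr : ∀ Z : Finset V, ∑ i ∈ Z, r i ≤ fhash H α Z) {X Y : Finset V}
    (hY : ∑ i ∈ Y, r i = fhash H α Y) (hXY : (X ∩ Y).Nonempty) :
    fhash H α (X ∪ Y) - ∑ i ∈ X ∪ Y, r i ≤ fhash H α X - ∑ i ∈ X, r i := by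
  have hsum := sum_union_inter (s₁ := X) (s₂ := Y) (f := r)
  linarith [hr (X ∩ Y), fhash_inter_add_fhash_union_le hH α hXY]

/-- Absorbing a family of tight sets, each meeting `X`, does not increase the slack of `X`. -/
theorem fhash_sub_sum_union_biUnion_le {V : Type*} [Fintype V] [DecidableEq V]
    {H : Finset V → ℝ} (hH : IsPolymatroid H) {α : ℝ} {r : V → ℝ}
    (hr : ∀ Z : Finset V, ∑ i ∈ Z, r i ≤ fhash H α Z) {X : Finset V}
    {U : Finset (Finset V)} (hU : ∀ Y ∈ U, ∑ i ∈ Y, r i = fhash H α Y)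
    (hXU : ∀ Y ∈ U, (X ∩ Y).Nonempty) :
    fhash H α (X ∪ U.biUnion id) - ∑ i ∈ X ∪ U.biUnion id, r i
      ≤ fhash H α X - ∑ i ∈ X, r i := by
  induction U using Finset.induction_on with
  | empty => simp
  | insert Y U _ ih =>
    have hset : X ∪ (insert Y U).biUnion id = (X ∪ U.biUnion id) ∪ Y := by
      rw [biUnion_insert, id, union_comm Y, union_assoc]
    rw [hset]
    exact (fhash_sub_sum_union_le hH hr (hU Y (mem_insert_self Y U))
      ((hXU Y (mem_insert_self Y U)).mono
        (inter_subset_inter_right subset_union_left))).trans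
      (ih (fun Z hZ => hU Z (mem_insert_of_mem hZ)) fun Z hZ => hXU Z (mem_insert_of_mem hZ))

/-- fusion lemma: the saturation capacity minimization over all
`X` with `φ ∈ X ⊆ W ∪ {φ}` equals the minimization over fused sets `{φ} ∪ Ũ`
for subcollections `U ⊆ P*`. -/
theorem fusion_lemma {V : Type*} [Fintype V] [DecidableEq V]
    (H : Finset V → ℝ) (hV : 2 ≤ Fintype.card V) (hH : IsPolymatroid H) (α : ℝ)
    (W : Finset V) (hW : W ⊂ Finset.univ)
    (Pstar : Finset (Finset V)) (hPstar : IsPartitionOf W Pstar)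
    (φ : V) (hφ : φ ∉ W) (r : V → ℝ)
    (hr₁ : ∀ Z : Finset V, ∑ i ∈ Z, r i ≤ fhash H α Z)
    (hr₂ : ∀ Y ∈ Pstar, ∑ i ∈ Y, r i = fhash H α Y) :
    sInf {s : ℝ | ∃ X : Finset V, φ ∈ X ∧ X ⊆ insert φ W ∧
        s = fhash H α X - ∑ i ∈ X, r i}
      = sInf {s : ℝ | ∃ U ⊆ Pstar,
          s = fhash H α (insert φ (U.biUnion id))
              - ∑ i ∈ insert φ (U.biUnion id), r i} := by
  have hbdd : ∀ S : Set ℝ, (∀ s ∈ S, ∃ X : Finset V, s = fhash H α X - ∑ i ∈ X, r i) →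
      BddBelow S := by
    refine fun S hS => ⟨0, fun s hs => ?_⟩
    obtain ⟨X, rfl⟩ := hS s hs
    exact sub_nonneg.mpr (hr₁ X)
  apply le_antisymm
  · refine csInf_le_csInf (hbdd _ ?_) ⟨_, ∅, empty_subset _, rfl⟩ ?_
    · rintro s ⟨X, -, -, rfl⟩
      exact ⟨X, rfl⟩
    · rintro s ⟨U, hU, rfl⟩
      refine ⟨_, mem_insert_self _ _, insert_subset_insert _ ?_, rfl⟩
      rw [← hPstar.2.2]
      exact biUnion_subset_biUnion_of_subset_left _ hU
  · refine le_csInf ⟨_, {φ}, mem_singleton_self φ, by simp, rfl⟩ ?_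
    rintro s ⟨X, hφX, hXW, rfl⟩
    let U := Pstar.filter fun Y => (X ∩ Y).Nonempty
    have hset : X ∪ U.biUnion id = insert φ (U.biUnion id) := by
      apply Subset.antisymm
      · refine union_subset (fun x hx => ?_) (subset_insert _ _)
        rcases mem_insert.mp (hXW hx) with rfl | hxW
        · exact mem_insert_self _ _
        · rw [← hPstar.2.2] at hxW
          obtain ⟨Y, hY, hxY⟩ := mem_biUnion.mp hxW
          exact mem_insert_of_mem (mem_biUnion.mpr
            ⟨Y, mem_filter.mpr ⟨hY, x, mem_inter.mpr ⟨hx, hxY⟩⟩, hxY⟩)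
      · exact insert_subset (mem_union_left _ hφX) subset_union_right
    refine le_trans (csInf_le (hbdd _ ?_) ⟨U, filter_subset _ _, rfl⟩) ?_
    · rintro s ⟨U, -, rfl⟩
      exact ⟨_, rfl⟩
    · rw [← hset]
      exact fhash_sub_sum_union_biUnion_le hH hr₁
        (fun Y hY => hr₂ Y (mem_filter.mp hY).1) fun Y hY => (mem_filter.mp hY).2
end
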